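/- For the category of partitions C = ⟨⨯, ↑, ⊓⊓⟩ generated by the crossing partition, the singleton and the four block partition, one has F(C) = Z_2^{*∞}, i.e. every element of Z_2^{*∞} is of the form w(p,l) for some p ∈ C and labelling l. -/

import Mathlib

open Classical

/-- A partition diagram with `upper` upper points and `lower` lower points; the blocks are
encoded by the equivalence relation (setoid) on the disjoint union of the points. -/
structure PartitionDiagram where
  upper : ℕ
  lower : ℕ
  rel : Setoid (Fin upper ⊕ Fin lower)

namespace PartitionDiagram

/-- The partition determined by a labelling of the points: two points lie in the same block
iff they receive the same label. -/
def ofLabels {u l : ℕ} (f : Fin u ⊕ Fin l → ℕ) : PartitionDiagram :=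
  ⟨u, l, Setoid.ker f⟩

/-- The identity partition `| ∈ P(1,1)`. -/
def idPartition : PartitionDiagram := ofLabels (u := 1) (l := 1) fun _ => 0

/-- The pair partition `⊓ ∈ P(0,2)`. -/
def pairPartition : PartitionDiagram := ofLabels (u := 0) (l := 2) fun _ => 0

/-- The four block partition `⊓⊓ ∈ P(0,4)`. -/
def fourBlock : PartitionDiagram := ofLabels (u := 0) (l := 4) fun _ => 0

/-- The singleton partition `↑ ∈ P(0,1)`. -/
def singletonPartition : PartitionDiagram := ofLabels (u := 0) (l := 1) fun _ => 0

/-- The double singleton partition `↑⊗↑ ∈ P(0,2)`. -/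
def doubleSingleton : PartitionDiagram :=
  ofLabels (u := 0) (l := 2) (Sum.elim (fun i => (i : ℕ)) fun j => (j : ℕ))

/-- The crossing partition `⨯ ∈ P(2,2)`, with blocks `{1,2'}` and `{2,1'}`. -/
def crossing : PartitionDiagram :=
  ofLabels (u := 2) (l := 2) (Sum.elim (fun i => (i : ℕ)) fun j => 1 - (j : ℕ))

/-- The pair positioner partition `▷ ∈ P(3,3)`, with blocks `{1,2,2',3'}` and `{3,1'}`. -/
def pairPositioner : PartitionDiagram :=
  ofLabels (u := 3) (l := 3)
    (Sum.elim (fun i => if (i : ℕ) = 2 then 1 else 0) fun j => if (j : ℕ) = 0 then 1 else 0)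

/-- The partition `k_l ∈ P(l+2, l+2)` consisting of the four block `{1, 1', l+2, (l+2)'}`
together with the pairs `{j, j'}` for `2 ≤ j ≤ l+1`. -/
def kPart (n : ℕ) : PartitionDiagram :=
  ofLabels (u := n + 2) (l := n + 2)
    (fun x => if (Sum.elim Fin.val Fin.val x) = 0 ∨ (Sum.elim Fin.val Fin.val x) = n + 1
      then 0 else Sum.elim Fin.val Fin.val x)

/-- The involution `p* ∈ P(l,k)` of `p ∈ P(k,l)`: turn the partition upside down. -/
def invol (p : PartitionDiagram) : PartitionDiagram :=
  ⟨p.lower, p.upper, Setoid.comap Sum.swap p.rel⟩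

/-- Auxiliary map splitting the points of a tensor product into the points of the two factors. -/
def splitPoint {a b c d : ℕ} (x : Fin (a + b) ⊕ Fin (c + d)) :
    (Fin a ⊕ Fin c) ⊕ (Fin b ⊕ Fin d) :=
  match x with
  | Sum.inl u =>
    match finSumFinEquiv.symm u with
    | Sum.inl i => Sum.inl (Sum.inl i)
    | Sum.inr i => Sum.inr (Sum.inl i)
  | Sum.inr v =>
    match finSumFinEquiv.symm v with
    | Sum.inl j => Sum.inl (Sum.inr j)
    | Sum.inr j => Sum.inr (Sum.inr j)

/-- The tensor product (horizontal concatenation) `p ⊗ q` of two partitions. -/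
def tensor (p q : PartitionDiagram) : PartitionDiagram :=
  ⟨p.upper + q.upper, p.lower + q.lower,
    Setoid.ker fun x =>
      Sum.map (Quotient.mk p.rel) (Quotient.mk q.rel) (splitPoint x)⟩

section Composition

variable (p q : PartitionDiagram) (h : p.lower = q.upper)

/-- Inclusion of the points of `p` into the three-row diagram used for composition. -/
def iotaP : Fin p.upper ⊕ Fin p.lower → Fin p.upper ⊕ (Fin p.lower ⊕ Fin q.lower) :=
  Sum.map id Sum.inl

/-- Inclusion of the points of `q` into the three-row diagram used for composition,
identifying the upper points of `q` with the lower points of `p`. -/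
def iotaQ : Fin q.upper ⊕ Fin q.lower → Fin p.upper ⊕ (Fin p.lower ⊕ Fin q.lower) :=
  fun x => Sum.inr (Sum.map (Fin.cast h.symm) id x)

/-- The generating relation on the three-row diagram used for composition. -/
def compRel : Fin p.upper ⊕ (Fin p.lower ⊕ Fin q.lower) →
    Fin p.upper ⊕ (Fin p.lower ⊕ Fin q.lower) → Prop :=
  fun x y =>
    (∃ a b, p.rel.r a b ∧ x = iotaP p q a ∧ y = iotaP p q b) ∨
    (∃ a b, q.rel.r a b ∧ x = iotaQ p q h a ∧ y = iotaQ p q h b)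

/-- The composition (vertical concatenation) `qp ∈ P(k,m)` of `p ∈ P(k,l)` and `q ∈ P(l,m)`:
identify the lower points of `p` with the upper points of `q`, take the join of the block
structures and restrict to the upper points of `p` and the lower points of `q`. -/
def comp : PartitionDiagram :=
  ⟨p.upper, q.lower,
    Setoid.comap (Sum.map id Sum.inr) (Relation.EqvGen.setoid (compRel p q h))⟩

end Composition

/-- Rotation of the leftmost upper point to the leftmost lower position. -/
def rotLU (p : PartitionDiagram) (h : 0 < p.upper) : PartitionDiagram :=
  ⟨p.upper - 1, p.lower + 1,
    Setoid.comap (fun x => match x with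
      | Sum.inl j => Sum.inl (⟨(j : ℕ) + 1, by have := j.isLt; omega⟩ : Fin p.upper)
      | Sum.inr j => if hj : (j : ℕ) = 0 then Sum.inl (⟨0, h⟩ : Fin p.upper)
          else Sum.inr (⟨(j : ℕ) - 1, by have := j.isLt; omega⟩ : Fin p.lower)) p.rel⟩

/-- Rotation of the leftmost lower point to the leftmost upper position. -/
def rotLD (p : PartitionDiagram) (h : 0 < p.lower) : PartitionDiagram :=
  ⟨p.upper + 1, p.lower - 1,
    Setoid.comap (fun x => match x with
      | Sum.inl j => if hj : (j : ℕ) = 0 then Sum.inr (⟨0, h⟩ : Fin p.lower)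
          else Sum.inl (⟨(j : ℕ) - 1, by have := j.isLt; omega⟩ : Fin p.upper)
      | Sum.inr j => Sum.inr (⟨(j : ℕ) + 1, by have := j.isLt; omega⟩ : Fin p.lower)) p.rel⟩

/-- Rotation of the rightmost upper point to the rightmost lower position. -/
def rotRU (p : PartitionDiagram) (h : 0 < p.upper) : PartitionDiagram :=
  ⟨p.upper - 1, p.lower + 1,
    Setoid.comap (fun x => match x with
      | Sum.inl j => Sum.inl (⟨(j : ℕ), by have := j.isLt; omega⟩ : Fin p.upper)
      | Sum.inr j => if hj : (j : ℕ) < p.lower then Sum.inr (⟨(j : ℕ), hj⟩ : Fin p.lower)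
          else Sum.inl (⟨p.upper - 1, by omega⟩ : Fin p.upper)) p.rel⟩

/-- Rotation of the rightmost lower point to the rightmost upper position. -/
def rotRD (p : PartitionDiagram) (h : 0 < p.lower) : PartitionDiagram :=
  ⟨p.upper + 1, p.lower - 1,
    Setoid.comap (fun x => match x with
      | Sum.inl j => if hj : (j : ℕ) < p.upper then Sum.inl (⟨(j : ℕ), hj⟩ : Fin p.upper)
          else Sum.inr (⟨p.lower - 1, by omega⟩ : Fin p.lower)
      | Sum.inr j => Sum.inr (⟨(j : ℕ), by have := j.isLt; omega⟩ : Fin p.lower)) p.rel⟩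

/-- The partition obtained from `p` by merging the block of the point `a` and the block of
the point `b` into a single block, leaving all other blocks unchanged. -/
noncomputable def mergeBlocks (p : PartitionDiagram)
    (a b : Fin p.upper ⊕ Fin p.lower) : PartitionDiagram :=
  ⟨p.upper, p.lower,
    Setoid.ker fun x =>
      if p.rel.r x a ∨ p.rel.r x b then (none : Option (Quotient p.rel))
      else some (Quotient.mk p.rel x)⟩

end PartitionDiagram

open PartitionDiagram

/-- A set of partitions is a category of partitions if it contains the identity partition and
the pair partition and is closed under tensor products, composition, involution and the four
rotation operations. -/
structure IsPartitionCategory (M : Set PartitionDiagram) : Prop where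
  id_mem : idPartition ∈ M
  pair_mem : pairPartition ∈ M
  tensor_mem : ∀ p ∈ M, ∀ q ∈ M, tensor p q ∈ M
  comp_mem : ∀ p ∈ M, ∀ q ∈ M, ∀ h : p.lower = q.upper, comp p q h ∈ M
  invol_mem : ∀ p ∈ M, invol p ∈ M
  rotLU_mem : ∀ p ∈ M, ∀ h : 0 < p.upper, rotLU p h ∈ M
  rotLD_mem : ∀ p ∈ M, ∀ h : 0 < p.lower, rotLD p h ∈ M
  rotRU_mem : ∀ p ∈ M, ∀ h : 0 < p.upper, rotRU p h ∈ M
  rotRD_mem : ∀ p ∈ M, ∀ h : 0 < p.lower, rotRD p h ∈ M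

/-- A category of partitions is group-theoretical if it contains the pair positioner
partition `▷`. -/
def IsGroupTheoreticalCategory (M : Set PartitionDiagram) : Prop :=
  IsPartitionCategory M ∧ pairPositioner ∈ M

/-- The smallest category of partitions containing a given set of partitions. -/
def generatedCategory (S : Set PartitionDiagram) : Set PartitionDiagram :=
  ⋂₀ { M | IsPartitionCategory M ∧ S ⊆ M }

/-- The group `Z_2^{*∞}`: the free product of countably many copies of the cyclic group of
order two. -/
abbrev FreeZ2 := Monoid.CoprodI (fun _ : ℕ => Multiplicative (ZMod 2))

/-- The free generators `a_1, a_2, …` of `Z_2^{*∞}`, each of order two. -/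
def gen (n : ℕ) : FreeZ2 :=
  Monoid.CoprodI.of (i := n) (Multiplicative.ofAdd (1 : ZMod 2))

/-- A labelling of a partition assigns (indices of) pairwise distinct generators of
`Z_2^{*∞}` to the blocks: two points receive the same label iff they lie in the same block. -/
def IsLabelling (p : PartitionDiagram) (lab : Fin p.upper ⊕ Fin p.lower → ℕ) : Prop :=
  ∀ x y, lab x = lab y ↔ p.rel.r x y

/-- The word `w(p,l) ∈ Z_2^{*∞}` of a labelled partition: after rotating all upper points to
the right-hand end of the lower row, read off the generators assigned to the points from left
to right, i.e. read the lower points from left to right and then the upper points from right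
to left. -/
def wordOf (p : PartitionDiagram) (lab : Fin p.upper ⊕ Fin p.lower → ℕ) : FreeZ2 :=
  ((List.ofFn fun j : Fin p.lower => gen (lab (Sum.inr j))) ++
    (List.ofFn fun i : Fin p.upper => gen (lab (Sum.inl i))).reverse).prod

/-- `F(C) ⊆ Z_2^{*∞}` is the set of all `w(p,l)` where `p ∈ C` and `l` is a labelling. -/
def Fmap (M : Set PartitionDiagram) : Set FreeZ2 :=
  { g | ∃ p ∈ M, ∃ lab, IsLabelling p lab ∧ wordOf p lab = g }

/-- The set of partitions admitting a labelling whose word lies in `H`. -/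
def catOf (H : Set FreeZ2) : Set PartitionDiagram :=
  { p | ∃ lab, IsLabelling p lab ∧ wordOf p lab ∈ H }

/-- The endomorphism of `Z_2^{*∞}` identifying letters according to `f`, i.e. sending
`a_k` to `a_{f k}` for every `k`. -/
def identifyLetters (f : ℕ → ℕ) : Monoid.End FreeZ2 :=
  Monoid.CoprodI.lift fun i =>
    (Monoid.CoprodI.of (M := fun _ : ℕ => Multiplicative (ZMod 2)) (i := f i))

/-- The strong symmetric semigroup `sS_∞`: the subsemigroup of `End(Z_2^{*∞})` generated by
the finite identifications of letters. -/
def strongSymmetricSemigroup : Subsemigroup (Monoid.End FreeZ2) :=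
  Subsemigroup.closure
    { φ | ∃ f : ℕ → ℕ, (∃ n : ℕ, ∀ k, n ≤ k → f k = k) ∧ φ = identifyLetters f }

/-- A subset of `Z_2^{*∞}` is `sS_∞`-invariant if it is preserved by every element of the
strong symmetric semigroup. -/
def IsSSInvariant (H : Set FreeZ2) : Prop :=
  ∀ φ ∈ strongSymmetricSemigroup, ∀ g ∈ H, φ g ∈ H

/-- A partition is in single leg form if it has no upper points and no two consecutive
points belong to the same block. -/
def IsSingleLeg (p : PartitionDiagram) : Prop :=
  p.upper = 0 ∧
    ∀ i j : Fin p.lower, (j : ℕ) = (i : ℕ) + 1 → ¬ p.rel.r (Sum.inr i) (Sum.inr j)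

/-- `C_sl`: the set of all partitions in `C` with no upper points in single leg form. -/
def slSet (M : Set PartitionDiagram) : Set PartitionDiagram :=
  { p ∈ M | IsSingleLeg p }

/-- The partition with no upper points determined by a word (a list of letters): two points
lie in the same block iff the corresponding letters coincide. -/
def wordPartition (w : List ℕ) : PartitionDiagram :=
  ofLabels (u := 0) (l := w.length) (Sum.elim (fun i => (i : ℕ)) fun j => w.get j)

/-- The canonical letter of the block of a lower point: the least index of a point in its
block. -/
noncomputable def blockLabel (p : PartitionDiagram) (j : Fin p.lower) : ℕ :=
  sInf { i : ℕ | ∃ h : i < p.lower, p.rel.r (Sum.inr ⟨i, h⟩) (Sum.inr j) }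

/-- The canonical word of a partition with no upper points. -/
noncomputable def canonWord (p : PartitionDiagram) : List ℕ :=
  List.ofFn fun j : Fin p.lower => blockLabel p j

/-- Full reduction of a word over an alphabet of involutions: repeatedly delete adjacent
equal pairs of letters.  This computes the result of iterating the operation replacing every
exponent in the run-decomposition of the word by its parity. -/
def reduceWord (w : List ℕ) : List ℕ :=
  w.foldr (fun x acc => match acc with
    | [] => [x]
    | y :: rest => if x = y then rest else x :: y :: rest) []

/-- The single leg version of a partition with no upper points: the unique partition in
single leg form obtained by iteratively replacing every exponent in its run-decomposition by
its parity. -/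
noncomputable def singleLegVersion (p : PartitionDiagram) : PartitionDiagram :=
  wordPartition (reduceWord (canonWord p))

theorem isPartitionCategory_generatedCategory (S : Set PartitionDiagram) :
    IsPartitionCategory (generatedCategory S) where
  id_mem := fun _ hM => hM.1.id_mem
  pair_mem := fun _ hM => hM.1.pair_mem
  tensor_mem := fun p hp q hq M hM => hM.1.tensor_mem p (hp M hM) q (hq M hM)
  comp_mem := fun p hp q hq h M hM => hM.1.comp_mem p (hp M hM) q (hq M hM) h
  invol_mem := fun p hp M hM => hM.1.invol_mem p (hp M hM)
  rotLU_mem := fun p hp h M hM => hM.1.rotLU_mem p (hp M hM) h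
  rotLD_mem := fun p hp h M hM => hM.1.rotLD_mem p (hp M hM) h
  rotRU_mem := fun p hp h M hM => hM.1.rotRU_mem p (hp M hM) h
  rotRD_mem := fun p hp h M hM => hM.1.rotRD_mem p (hp M hM) h

theorem subset_generatedCategory (S : Set PartitionDiagram) : S ⊆ generatedCategory S :=
  fun _ hp _ hM => hM.2 hp

/-- `M` contains a partition with a labelling that reads `a` on the upper row and `b` on the
lower row, both from left to right. -/
def HasRows (M : Set PartitionDiagram) (a b : List ℕ) : Prop :=
  ∃ p ∈ M, ∃ lab, IsLabelling p lab ∧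
    List.ofFn (fun i : Fin p.upper => lab (Sum.inl i)) = a ∧
    List.ofFn (fun j : Fin p.lower => lab (Sum.inr j)) = b

section Rows

variable {M : Set PartitionDiagram}

theorem HasRows.rotLU (hM : IsPartitionCategory M) {x : ℕ} {a b : List ℕ}
    (H : HasRows M (x :: a) b) : HasRows M a (x :: b) := by
  obtain ⟨p, hp, lab, hlab, ha, hb⟩ := H
  have hu : p.upper = a.length + 1 := by simpa using congrArg List.length ha
  refine ⟨_, hM.rotLU_mem p hp (by omega), _, fun s t => hlab _ _, ?_, ?_⟩
  · refine List.ext_getElem (by simp [PartitionDiagram.rotLU, hu]) fun n h1 h2 => ?_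
    have : (x :: a)[n + 1]'(by simpa using h2) = a[n] := by simp
    rw [← this]
    simp [← ha]
  · subst hb
    refine List.ext_getElem (by simp [PartitionDiagram.rotLU]) fun n h1 h2 => ?_
    rcases n with _ | n
    · have : (x :: a)[0] = x := by simp
      simp only [List.getElem_cons_zero]
      rw [← this]
      simp [← ha]
    · simp

theorem HasRows.rotLD (hM : IsPartitionCategory M) {x : ℕ} {a b : List ℕ}
    (H : HasRows M a (x :: b)) : HasRows M (x :: a) b := by
  obtain ⟨p, hp, lab, hlab, ha, hb⟩ := H
  have hl : p.lower = b.length + 1 := by simpa using congrArg List.length hb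
  refine ⟨_, hM.rotLD_mem p hp (by omega), _, fun s t => hlab _ _, ?_, ?_⟩
  · subst ha
    refine List.ext_getElem (by simp [PartitionDiagram.rotLD]) fun n h1 h2 => ?_
    rcases n with _ | n
    · have : (x :: b)[0] = x := by simp
      simp only [List.getElem_cons_zero]
      rw [← this]
      simp [← hb]
    · simp
  · refine List.ext_getElem (by simp [PartitionDiagram.rotLD, hl]) fun n h1 h2 => ?_
    have : (x :: b)[n + 1]'(by simpa using h2) = b[n] := by simp
    rw [← this]
    simp [← hb]

theorem HasRows.rotRU (hM : IsPartitionCategory M) {x : ℕ} {a b : List ℕ}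
    (H : HasRows M (a ++ [x]) b) : HasRows M a (b ++ [x]) := by
  obtain ⟨p, hp, lab, hlab, ha, hb⟩ := H
  have hu : p.upper = a.length + 1 := by simpa using congrArg List.length ha
  refine ⟨_, hM.rotRU_mem p hp (by omega), _, fun s t => hlab _ _, ?_, ?_⟩
  · refine List.ext_getElem (by simp [PartitionDiagram.rotRU, hu]) fun n h1 h2 => ?_
    have : (a ++ [x])[n]'(by simp; omega) = a[n] := List.getElem_append_left h2
    rw [← this]
    simp [← ha]
  · subst hb
    refine List.ext_getElem (by simp [PartitionDiagram.rotRU]) fun n h1 h2 => ?_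
    by_cases hn : n < p.lower
    · simp [hn]
    · have e := List.getElem_of_eq ha (i := p.upper - 1) (by simp; omega)
      have hx : lab (Sum.inl ⟨p.upper - 1, by omega⟩) = x := by
        simp only [List.getElem_ofFn] at e
        simpa [hu] using e
      simp [hn, hx, List.getElem_append]

theorem HasRows.rotRD (hM : IsPartitionCategory M) {x : ℕ} {a b : List ℕ}
    (H : HasRows M a (b ++ [x])) : HasRows M (a ++ [x]) b := by
  obtain ⟨p, hp, lab, hlab, ha, hb⟩ := H
  have hl : p.lower = b.length + 1 := by simpa using congrArg List.length hb
  refine ⟨_, hM.rotRD_mem p hp (by omega), _, fun s t => hlab _ _, ?_, ?_⟩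
  · subst ha
    refine List.ext_getElem (by simp [PartitionDiagram.rotRD]) fun n h1 h2 => ?_
    by_cases hn : n < p.upper
    · simp [hn]
    · have e := List.getElem_of_eq hb (i := p.lower - 1) (by simp; omega)
      have hx : lab (Sum.inr ⟨p.lower - 1, by omega⟩) = x := by
        simp only [List.getElem_ofFn] at e
        simpa [hl] using e
      simp [hn, hx, List.getElem_append]
  · refine List.ext_getElem (by simp [PartitionDiagram.rotRD, hl]) fun n h1 h2 => ?_
    have : (b ++ [x])[n]'(by simp; omega) = b[n] := List.getElem_append_left h2
    rw [← this]
    simp [← hb]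

theorem hasRows_nil_cons_iff (hM : IsPartitionCategory M) {x : ℕ} {w : List ℕ} :
    HasRows M [] (x :: w) ↔ HasRows M [] (w ++ [x]) :=
  ⟨fun H => HasRows.rotRU (a := []) hM (H.rotLD hM),
    fun H => HasRows.rotLU hM (HasRows.rotRD (a := []) hM H)⟩

theorem HasRows.append_comm (hM : IsPartitionCategory M) {a b : List ℕ}
    (H : HasRows M [] (a ++ b)) : HasRows M [] (b ++ a) := by
  induction a generalizing b with
  | nil => simpa using H
  | cons x a ih =>
    have := ih (b := b ++ [x]) (by simpa using (hasRows_nil_cons_iff hM).1 H)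
    simpa using this

theorem hasRows_iff_word (hM : IsPartitionCategory M) {a b : List ℕ} :
    HasRows M a b ↔ HasRows M [] (b ++ a.reverse) := by
  induction a generalizing b with
  | nil => simp
  | cons x a ih =>
    have h : HasRows M (x :: a) b ↔ HasRows M a (x :: b) :=
      ⟨fun H => H.rotLU hM, fun H => H.rotLD hM⟩
    rw [h, ih, List.cons_append, hasRows_nil_cons_iff hM, List.reverse_cons, List.append_assoc]

/-- Composing a labelled partition with a partition `q` whose lower points are all connected to
upper points of `q` transports the labels along `q`. -/
theorem HasRows.comp (hM : IsPartitionCategory M) {a b : List ℕ} (H : HasRows M a b)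
    {q : PartitionDiagram} (hq : q ∈ M) (lab' : Fin q.upper ⊕ Fin q.lower → ℕ)
    (hrel : ∀ s t, q.rel.r s t → lab' s = lab' t)
    (hconn : ∀ j, ∃ i, q.rel.r (Sum.inr j) (Sum.inl i))
    (hb : List.ofFn (fun i => lab' (Sum.inl i)) = b) :
    HasRows M a (List.ofFn fun j => lab' (Sum.inr j)) := by
  obtain ⟨p, hp, lab, hlab, ha, hb'⟩ := H
  have h : p.lower = q.upper := by
    simpa using congrArg List.length (hb'.trans hb.symm)
  have hmid : ∀ i : Fin q.upper, lab (Sum.inr (Fin.cast h.symm i)) = lab' (Sum.inl i) := by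
    intro i
    have e := List.getElem_of_eq (hb'.trans hb.symm) (i := i) (by simp [h])
    simp only [List.getElem_ofFn] at e
    exact e
  let F : Fin p.upper ⊕ (Fin p.lower ⊕ Fin q.lower) → ℕ :=
    Sum.elim (fun i => lab (Sum.inl i))
      (Sum.elim (fun j => lab (Sum.inr j)) (fun j => lab' (Sum.inr j)))
  have hP : ∀ s, F (iotaP p q s) = lab s := by rintro (s | s) <;> rfl
  have hQ : ∀ s, F (iotaQ p q h s) = lab' s := by
    rintro (s | s)
    · exact hmid s
    · rfl
  have hF : ∀ s t, Relation.EqvGen (compRel p q h) s t → F s = F t := by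
    intro s t hst
    induction hst with
    | rel s t hst =>
      rcases hst with ⟨c, d, hcd, rfl, rfl⟩ | ⟨c, d, hcd, rfl, rfl⟩
      · rw [hP, hP]; exact (hlab _ _).2 hcd
      · rw [hQ, hQ]; exact hrel _ _ hcd
    | refl => rfl
    | symm _ _ _ ih => exact ih.symm
    | trans _ _ _ _ _ ih1 ih2 => exact ih1.trans ih2
  have hreach : ∀ s, ∃ c, Relation.EqvGen (compRel p q h) s (iotaP p q c) := by
    rintro (s | s | s)
    · exact ⟨Sum.inl s, .refl _⟩
    · exact ⟨Sum.inr s, .refl _⟩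
    · obtain ⟨i, hi⟩ := hconn s
      exact ⟨Sum.inr (Fin.cast h.symm i), .rel _ _ (Or.inr ⟨_, _, hi, rfl, rfl⟩)⟩
  refine ⟨_, hM.comp_mem p hp q hq h, fun s => F (Sum.map id Sum.inr s), fun s t => ?_, ha, rfl⟩
  refine ⟨fun hst => ?_, fun hst => hF _ _ hst⟩
  obtain ⟨c, hc⟩ := hreach (Sum.map id Sum.inr s)
  obtain ⟨d, hd⟩ := hreach (Sum.map id Sum.inr t)
  have hcd : p.rel.r c d := by
    rw [← hlab, ← hP, ← hP, ← hF _ _ hc, ← hF _ _ hd]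
    exact hst
  exact .trans _ _ _ hc (.trans _ _ _ (.rel _ _ (Or.inl ⟨c, d, hcd, rfl, rfl⟩)) (.symm _ _ hd))

theorem HasRows.swap (hM : IsPartitionCategory M) (hcr : crossing ∈ M) {x y : ℕ} {w : List ℕ}
    (H : HasRows M [] (x :: y :: w)) : HasRows M [] (y :: x :: w) := by
  have H' : HasRows M w.reverse [x, y] := by
    rw [hasRows_iff_word hM]; simpa using H
  let lab : Fin 2 ⊕ Fin 2 → ℕ := Sum.elim ![x, y] ![y, x]
  have hlab : ∀ s t : Fin 2 ⊕ Fin 2,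
      Sum.elim (fun i : Fin 2 => (i : ℕ)) (fun j : Fin 2 => 1 - (j : ℕ)) s =
        Sum.elim (fun i : Fin 2 => (i : ℕ)) (fun j : Fin 2 => 1 - (j : ℕ)) t →
      lab s = lab t := by
    rintro (s | s) (t | t) <;> fin_cases s <;> fin_cases t <;> simp [lab]
  have K := H'.comp hM hcr lab hlab
    (by
      intro (j : Fin 2)
      refine ⟨(1 - j : Fin 2), ?_⟩
      change (1 - (j : ℕ)) = ((1 - j : Fin 2) : ℕ)
      fin_cases j <;> rfl)
    (by rfl)
  have K' : HasRows M w.reverse [y, x] := K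
  rw [hasRows_iff_word hM] at K'
  simpa using K'

theorem HasRows.tripleHead (hM : IsPartitionCategory M) (hf : fourBlock ∈ M) {x : ℕ}
    {w : List ℕ} (H : HasRows M [] (x :: w)) : HasRows M [] (x :: x :: x :: w) := by
  have H' : HasRows M w.reverse [x] := by
    rw [hasRows_iff_word hM]; simpa using H
  have K := H'.comp hM (hM.rotLD_mem _ hf (by decide)) (fun _ => x) (fun _ _ _ => rfl)
    (fun _ => ⟨(0 : Fin 1), rfl⟩) rfl
  have K' : HasRows M w.reverse [x, x, x] := K
  rw [hasRows_iff_word hM] at K'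
  simpa using K'

theorem HasRows.dropHead (hM : IsPartitionCategory M) (hs : singletonPartition ∈ M) {x : ℕ}
    {w : List ℕ} (H : HasRows M [] (x :: w)) : HasRows M [] w := by
  have H' : HasRows M w.reverse [x] := by
    rw [hasRows_iff_word hM]; simpa using H
  have K := H'.comp hM (hM.invol_mem _ hs) (fun _ => x) (fun _ _ _ => rfl)
    (fun j : Fin 0 => j.elim0) rfl
  have K' : HasRows M w.reverse [] := K
  rw [hasRows_iff_word hM] at K'
  simpa using K'

theorem HasRows.rotateTail (hM : IsPartitionCategory M) (hcr : crossing ∈ M) {x : ℕ}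
    {b c : List ℕ} (H : HasRows M [] (x :: (b ++ c))) : HasRows M [] (x :: (c ++ b)) := by
  induction b generalizing c with
  | nil => simpa using H
  | cons y b ih =>
    have K := (hasRows_nil_cons_iff hM).1 (HasRows.swap hM hcr H)
    have := ih (c := c ++ [y]) (by simpa using K)
    simpa using this

theorem HasRows.cons_of_mem (hM : IsPartitionCategory M) (hcr : crossing ∈ M)
    (hs : singletonPartition ∈ M) (hf : fourBlock ∈ M) {x : ℕ} {w : List ℕ} (hx : x ∈ w)
    (H : HasRows M [] w) : HasRows M [] (x :: w) := by
  obtain ⟨a, b, rfl⟩ := List.append_of_mem hx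
  have h1 : HasRows M [] (x :: (b ++ a)) := by
    simpa using HasRows.append_comm hM H
  have h2 := (h1.tripleHead hM hf).dropHead hM hs
  have h3 := (hasRows_nil_cons_iff hM).1 h2
  have h4 := HasRows.rotateTail hM hcr (c := a ++ [x]) (by simpa using h3)
  simpa using h4

theorem IsLabelling.tensor {p q : PartitionDiagram} {f : Fin p.upper ⊕ Fin p.lower → ℕ}
    {g : Fin q.upper ⊕ Fin q.lower → ℕ} (hf : IsLabelling p f) (hg : IsLabelling q g)
    (hfg : ∀ s t, f s ≠ g t) :
    IsLabelling (PartitionDiagram.tensor p q) (fun s => Sum.elim f g (splitPoint s)) := by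
  intro s t
  change _ ↔ Sum.map (Quotient.mk p.rel) (Quotient.mk q.rel) (splitPoint s) =
    Sum.map (Quotient.mk p.rel) (Quotient.mk q.rel) (splitPoint t)
  beta_reduce
  generalize splitPoint s = s', splitPoint t = t'
  rcases s' with c | c <;> rcases t' with d | d
  · simpa [Quotient.eq] using hf c d
  · simpa using hfg c d
  · simpa using (hfg d c).symm
  · simpa [Quotient.eq] using hg c d

theorem ofFn_tensor_lower {p q : PartitionDiagram} (f : Fin p.upper ⊕ Fin p.lower → ℕ)
    (g : Fin q.upper ⊕ Fin q.lower → ℕ) :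
    List.ofFn (fun j : Fin (PartitionDiagram.tensor p q).lower =>
        Sum.elim f g (splitPoint (Sum.inr j))) =
      List.ofFn (fun j => f (Sum.inr j)) ++ List.ofFn (fun j => g (Sum.inr j)) := by
  change List.ofFn (n := p.lower + q.lower) (fun j => Sum.elim f g
    (splitPoint (a := p.upper) (b := q.upper) (Sum.inr j))) = _
  rw [List.ofFn_add]
  congr 1
  · congr 1
    funext i
    change Sum.elim f g (splitPoint (Sum.inr (Fin.castAdd _ i))) = _
    simp [splitPoint]
  · simp [splitPoint]

theorem isLabelling_singletonPartition (x : ℕ) :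
    IsLabelling singletonPartition (fun _ => x) :=
  fun _ _ => ⟨fun _ => rfl, fun _ => rfl⟩

theorem HasRows.cons_of_notMem (hM : IsPartitionCategory M) (hs : singletonPartition ∈ M)
    {x : ℕ} {w : List ℕ} (hx : x ∉ w) (H : HasRows M [] w) : HasRows M [] (x :: w) := by
  obtain ⟨p, hp, lab, hlab, ha, hb⟩ := H
  have hu : p.upper = 0 := by simpa using congrArg List.length ha
  refine ⟨_, hM.tensor_mem _ hs _ hp, _,
    (isLabelling_singletonPartition x).tensor hlab ?_, ?_, ?_⟩
  · rintro s (t | t)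
    · exact (Fin.cast hu t).elim0
    · rintro rfl
      exact hx (hb ▸ List.mem_ofFn.2 ⟨t, rfl⟩)
  · rw [← List.length_eq_zero_iff, List.length_ofFn]
    simp [PartitionDiagram.tensor, singletonPartition, ofLabels, hu]
  · exact (ofFn_tensor_lower _ lab).trans (by rw [hb]; rfl)

theorem hasRows_word (hM : IsPartitionCategory M) (hcr : crossing ∈ M)
    (hs : singletonPartition ∈ M) (hf : fourBlock ∈ M) (x : ℕ) (w : List ℕ) :
    HasRows M [] (x :: w) := by
  induction w generalizing x with
  | nil => exact ⟨_, hs, _, isLabelling_singletonPartition x, rfl, rfl⟩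
  | cons y w ih =>
    by_cases hx : x ∈ y :: w
    · exact (ih y).cons_of_mem hM hcr hs hf hx
    · exact (ih y).cons_of_notMem hM hs hx

theorem HasRows.mem_Fmap {w : List ℕ} (H : HasRows M [] w) : (w.map gen).prod ∈ Fmap M := by
  obtain ⟨p, hp, lab, hlab, ha, hb⟩ := H
  have e : List.ofFn (fun i : Fin p.upper => gen (lab (Sum.inl i))) = [] := by
    rw [← List.map_nil (f := gen), ← ha, List.map_ofFn]
    rfl
  refine ⟨p, hp, lab, hlab, ?_⟩
  rw [wordOf, e, ← hb, List.map_ofFn, List.reverse_nil, List.append_nil]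
  rfl

end Rows

theorem gen_mul_self (n : ℕ) : gen n * gen n = 1 := by
  rw [gen, ← map_mul, ← map_one (Monoid.CoprodI.of (i := n))]
  rfl

theorem exists_word (g : FreeZ2) : ∃ w : List ℕ, (w.map gen).prod = g := by
  induction g using Monoid.CoprodI.induction_on with
  | one => exact ⟨[], rfl⟩
  | of i m =>
    have hm : m = 1 ∨ m = Multiplicative.ofAdd (1 : ZMod 2) := by
      revert m; decide
    rcases hm with rfl | rfl
    · exact ⟨[], by simp⟩
    · exact ⟨[i], by simp [gen]⟩
  | mul x y hx hy =>
    obtain ⟨v, rfl⟩ := hx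
    obtain ⟨w, rfl⟩ := hy
    exact ⟨v ++ w, by simp⟩

/-- For the category of partitions `C = ⟨⨯, ↑, ⊓⊓⟩` generated by the crossing
partition, the singleton and the four block partition, one has `F(C) = Z_2^{*∞}`. -/
theorem Fmap_generated_crossing_singleton_fourBlock :
    Fmap (generatedCategory
        {PartitionDiagram.crossing, PartitionDiagram.singletonPartition,
          PartitionDiagram.fourBlock}) = Set.univ := by
  refine Set.eq_univ_of_forall fun g => ?_
  obtain ⟨w, rfl⟩ := exists_word g
  have key := hasRows_word (isPartitionCategory_generatedCategory _)
    (subset_generatedCategory {crossing, singletonPartition, fourBlock} (by simp))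
    (subset_generatedCategory _ (by simp)) (subset_generatedCategory _ (by simp))
  rcases w with _ | ⟨x, w⟩
  · simpa [gen_mul_self] using (key 0 [0]).mem_Fmap
  · exact (key x w).mem_Fmap
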